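/- (Proposition 2) For every vector ψ in the a-magnon sector ℋ_a one has ⟨ψ, H ψ⟩ ≥ ((1−a)·N·j/8)·‖ψ‖² + ⟨𝒥_a ψ, K_a 𝒥_a ψ⟩; that is, the operator inequality H|_{ℋ_a} ≥ (1−a)·N·j/8 · Id + 𝒥_a* K_a 𝒥_a holds. -/

import Mathlib

open Matrix BigOperators
open scoped ComplexOrder

/-- Spin-1/2 configurations: `true` means spin down. -/
abbrev Conf (V : Type*) := V → Bool

variable {V : Type*}

/-- The operator `P_{uv}` interchanging the spin values at sites `u` and `v`. -/
noncomputable def swapOp [Fintype V] [DecidableEq V] (u v : V) :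
    Matrix (Conf V) (Conf V) ℂ :=
  Matrix.of fun σ τ => if τ = σ ∘ (Equiv.swap u v) then 1 else 0

lemma swapOp_comm [Fintype V] [DecidableEq V] (u v : V) :
    swapOp (V := V) u v = swapOp v u := by
  unfold swapOp
  rw [Equiv.swap_comm]

/-- The spin-1/2 Heisenberg Hamiltonian `H = Σ_{{u,v} ∈ E(G)} ((1/2)·P_{uv} − (1/4)·Id)`. -/
noncomputable def Ham [Fintype V] [DecidableEq V] (G : SimpleGraph V) [DecidableRel G.Adj] :
    Matrix (Conf V) (Conf V) ℂ :=
  ∑ e ∈ G.edgeFinset,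
    Sym2.lift ⟨fun u v => (1/2 : ℂ) • swapOp u v - (1/4 : ℂ) • 1,
      fun u v => by dsimp only; rw [swapOp_comm]⟩ e

/-- The configuration `σ_n` whose single down spin is at `n`. -/
def singleDown [DecidableEq V] (n : V) : Conf V := fun w => decide (w = n)

/-- The one-magnon block `H₁` of `H`, as a matrix indexed by `V`
(via the identification `e_{σ_n} ↦ e_n`). -/
noncomputable def H1 [Fintype V] [DecidableEq V] (G : SimpleGraph V) [DecidableRel G.Adj] :
    Matrix V V ℂ :=
  Matrix.of fun m n => Ham G (singleDown m) (singleDown n)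

/-- Number of down spins `|A_σ|` of a configuration. -/
def downCard [Fintype V] (σ : Conf V) : ℕ := (Finset.univ.filter fun u => σ u = true).card

/-- `e(A_σ, V∖A_σ)`: the number of edges joining the down-set to its complement. -/
noncomputable def crossCount (G : SimpleGraph V) (σ : Conf V) : ℕ :=
  {e : Sym2 V | e ∈ G.edgeSet ∧ ∃ u v : V, σ u = true ∧ σ v = false ∧ e = s(u, v)}.ncard

/-- `e(A_σ)`: the number of edges with both endpoints in the down-set. -/
noncomputable def inCount (G : SimpleGraph V) (σ : Conf V) : ℕ :=
  {e : Sym2 V | e ∈ G.edgeSet ∧ ∀ u ∈ e, σ u = true}.ncard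

/-- The `a`-fold Kronecker sum `K_a` of a matrix `M`. -/
noncomputable def kron {W : Type*} [Fintype W] [DecidableEq W] (a : ℕ) (M : Matrix W W ℂ) :
    Matrix (Fin a → W) (Fin a → W) ℂ :=
  Matrix.of fun f g =>
    ∑ i, M (f i) (g i) * ∏ j ∈ Finset.univ.erase i, (if f j = g j then (1 : ℂ) else 0)

/-- The isometric embedding `𝒥_a : ℋ_a → ((Fin a → V) → ℂ)`,
`𝒥_a e_σ = (a!)^{-1/2} Σ_f e_f`, `f` ranging over bijections `Fin a → A_σ`. -/
noncomputable def Ja [Fintype V] [DecidableEq V] (a : ℕ) :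
    Matrix (Fin a → V) (Conf V) ℂ :=
  Matrix.of fun f σ =>
    if Function.Injective f ∧ (∀ u, σ u = true ↔ ∃ i, f i = u)
    then (Real.sqrt (Nat.factorial a) : ℂ)⁻¹ else 0

open Finset in
/-- Twice a sum over edges is the corresponding sum over ordered adjacent pairs. -/
lemma two_nsmul_sum_edgeFinset [Fintype V] (G : SimpleGraph V) [DecidableRel G.Adj]
    {M : Type*} [AddCommMonoid M] (F : Sym2 V → M) :
    2 • ∑ e ∈ G.edgeFinset, F e = ∑ u, ∑ v, if G.Adj u v then F s(u, v) else 0 := by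
  classical
  have hfib : ∑ d : G.Dart, F d.edge = 2 • ∑ e ∈ G.edgeFinset, F e := by
    rw [← sum_fiberwise_of_maps_to' (s := univ) (t := G.edgeFinset) (g := fun d : G.Dart => d.edge)
      (fun d _ => by simp), smul_sum]
    refine sum_congr rfl fun e he => ?_
    rw [sum_const, G.dart_edge_fiber_card e (by simpa using he)]
  rw [← hfib, ← Fintype.sum_prod_type' (fun u v => if G.Adj u v then F s(u, v) else 0),
    ← sum_filter]
  refine sum_nbij (fun d => d.toProd) (fun d _ => by simp [d.adj])
    (SimpleGraph.Dart.toProd_injective.injOn)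
    (fun p hp => ⟨⟨p, by simpa using hp⟩, by simp⟩) fun d _ => rfl

/-- Indicator of the down-set of `σ`, with complex values. -/
noncomputable def downInd (σ : Conf V) (u : V) : ℂ := if σ u = true then 1 else 0

/-- The sum of the indicator of the down-set is its cardinality. -/
lemma sum_downInd [Fintype V] (σ : Conf V) : ∑ u, downInd σ u = downCard σ := by
  simp [downInd, downCard]

/-- The number of ordered adjacent pairs inside the down-set of `σ`. -/
def innerPairs [Fintype V] (G : SimpleGraph V) [DecidableRel G.Adj] (σ : Conf V) : ℕ :=
  ∑ u, ∑ v, if G.Adj u v ∧ σ u = true ∧ σ v = true then 1 else 0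

lemma swapOp_mulVec [Fintype V] [DecidableEq V] (u v : V) (ψ : Conf V → ℂ) (σ : Conf V) :
    (swapOp u v *ᵥ ψ) σ = ψ (σ ∘ Equiv.swap u v) := by
  simp [swapOp, mulVec, dotProduct]

lemma comp_swap_eq_self [DecidableEq V] {σ : Conf V} {u v : V} (h : σ u = σ v) :
    σ ∘ Equiv.swap u v = σ := by
  funext w
  rcases eq_or_ne w u with rfl | hu
  · simp [h]
  rcases eq_or_ne w v with rfl | hv
  · simp [h]
  · simp [Equiv.swap_apply_of_ne_of_ne hu hv]

/-- Twice the action of `H`, as a sum over ordered adjacent pairs. -/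
lemma two_mul_Ham_mulVec [Fintype V] [DecidableEq V] (G : SimpleGraph V) [DecidableRel G.Adj]
    (ψ : Conf V → ℂ) (σ : Conf V) :
    2 * (Ham G *ᵥ ψ) σ = ∑ u, ∑ v,
      if G.Adj u v then (1 / 2 : ℂ) * ψ (σ ∘ Equiv.swap u v) - (1 / 4 : ℂ) * ψ σ else 0 := by
  have h := two_nsmul_sum_edgeFinset G (fun e => ((Sym2.lift
    ⟨fun u v => (1/2 : ℂ) • swapOp u v - (1/4 : ℂ) • (1 : Matrix (Conf V) (Conf V) ℂ),
      fun u v => by dsimp only; rw [swapOp_comm]⟩ e) *ᵥ ψ) σ)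
  rw [nsmul_eq_mul, Nat.cast_ofNat] at h
  rw [Ham, sum_mulVec, Finset.sum_apply, h]
  simp [sub_mulVec, smul_mulVec, swapOp_mulVec]

/-- Explicit action of `H` on a regular graph: diagonal part plus hopping across the cut. -/
lemma Ham_mulVec [Fintype V] [DecidableEq V] (G : SimpleGraph V) [DecidableRel G.Adj] {j : ℕ}
    (hreg : G.IsRegularOfDegree j) (ψ : Conf V → ℂ) (σ : Conf V) :
    (Ham G *ᵥ ψ) σ =
      ((Fintype.card V : ℂ) * j / 8 - j / 2 * downCard σ + innerPairs G σ / 2) * ψ σ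
      + 1 / 2 * ∑ u, ∑ v, if G.Adj u v ∧ σ u = true ∧ σ v = false
          then ψ (σ ∘ Equiv.swap u v) else 0 := by
  have hw (u : V) : ∑ v, G.adjMatrix ℂ u v = j := by
    simp [SimpleGraph.adjMatrix_apply, ← hreg u, ← SimpleGraph.card_neighborFinset_eq_degree,
      SimpleGraph.neighborFinset_eq_filter]
  have hw' (v : V) : ∑ u, G.adjMatrix ℂ u v = j := by
    rw [← hw v]
    exact Finset.sum_congr rfl fun u _ => by simp [SimpleGraph.adjMatrix_apply, G.adj_comm]
  set S := ∑ u, ∑ v, if G.Adj u v ∧ σ u = true ∧ σ v = false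
          then ψ (σ ∘ Equiv.swap u v) else 0 with hS
  have hS' : S = ∑ u, ∑ v, if G.Adj u v ∧ σ v = true ∧ σ u = false
          then ψ (σ ∘ Equiv.swap u v) else 0 := by
    rw [hS, Finset.sum_comm]
    simp only [G.adj_comm, Equiv.swap_comm]
  have h1 : ∑ u, ∑ v, G.adjMatrix ℂ u v = Fintype.card V * j := by
    simp only [hw, Finset.sum_const, Finset.card_univ, nsmul_eq_mul]
  have h2 : ∑ u, ∑ v, G.adjMatrix ℂ u v * downInd σ u = j * downCard σ := by
    simp_rw [← Finset.sum_mul, hw, ← Finset.mul_sum, sum_downInd]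
  have h3 : ∑ u, ∑ v, G.adjMatrix ℂ u v * downInd σ v = j * downCard σ := by
    rw [Finset.sum_comm]
    simp_rw [← Finset.sum_mul, hw', ← Finset.mul_sum, sum_downInd]
  have h4 : ∑ u, ∑ v, G.adjMatrix ℂ u v * (downInd σ u * downInd σ v) = innerPairs G σ := by
    rw [innerPairs]
    push_cast
    refine Finset.sum_congr rfl fun u _ => Finset.sum_congr rfl fun v _ => ?_
    simp only [downInd, SimpleGraph.adjMatrix_apply, ite_and]
    split_ifs <;> simp
  have key : 2 * (Ham G *ᵥ ψ) σ =
      1 / 2 * ((1 / 2 * ∑ u, ∑ v, G.adjMatrix ℂ u v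
        - ∑ u, ∑ v, G.adjMatrix ℂ u v * downInd σ u
        - ∑ u, ∑ v, G.adjMatrix ℂ u v * downInd σ v
        + 2 * ∑ u, ∑ v, G.adjMatrix ℂ u v * (downInd σ u * downInd σ v)) * ψ σ + S + S) := by
    nth_rw 2 [hS']
    rw [two_mul_Ham_mulVec, hS]
    simp only [Finset.mul_sum, Finset.sum_mul, ← Finset.sum_add_distrib, ← Finset.sum_sub_distrib]
    refine Finset.sum_congr rfl fun u _ => Finset.sum_congr rfl fun v _ => ?_
    by_cases hadj : G.Adj u v
    · cases hu : σ u <;> cases hv : σ v <;>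
        simp [hadj, hu, hv, downInd, SimpleGraph.adjMatrix_apply, comp_swap_eq_self] <;> ring
    · simp [hadj, SimpleGraph.adjMatrix_apply]
  rw [h1, h2, h3, h4] at key
  linear_combination key / 2

lemma downCard_singleDown [Fintype V] [DecidableEq V] (n : V) : downCard (singleDown n) = 1 := by
  simp only [downCard, singleDown, decide_eq_true_eq]
  rw [Finset.filter_eq' Finset.univ n, if_pos (Finset.mem_univ n), Finset.card_singleton]

lemma singleDown_injective [DecidableEq V] : Function.Injective (singleDown (V := V)) := by
  intro m n h
  simpa [singleDown] using congrFun h m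

lemma singleDown_comp_swap [DecidableEq V] (m v : V) :
    singleDown m ∘ Equiv.swap m v = singleDown v := by
  funext w
  simp [singleDown, Equiv.swap_apply_eq_iff]

lemma innerPairs_singleDown [Fintype V] [DecidableEq V] (G : SimpleGraph V)
    [DecidableRel G.Adj] (n : V) : innerPairs G (singleDown n) = 0 := by
  simp only [innerPairs, singleDown, decide_eq_true_eq]
  refine Finset.sum_eq_zero fun u _ => Finset.sum_eq_zero fun v _ => if_neg ?_
  rintro ⟨h, rfl, rfl⟩
  exact G.irrefl h

/-- The one-magnon block of `H` on a regular graph. -/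
lemma H1_apply [Fintype V] [DecidableEq V] (G : SimpleGraph V) [DecidableRel G.Adj] {j : ℕ}
    (hreg : G.IsRegularOfDegree j) (m n : V) :
    H1 G m n = (if n = m then (Fintype.card V : ℂ) * j / 8 - j / 2 else 0)
      + if G.Adj m n then 1 / 2 else 0 := by
  have h := Ham_mulVec G hreg (Pi.single (singleDown n) 1) (singleDown m)
  rw [mulVec_single_one] at h
  have hsum : (∑ u, ∑ v, if G.Adj u v ∧ singleDown m u = true ∧ singleDown m v = false
      then (Pi.single (singleDown n) 1 : Conf V → ℂ) (singleDown m ∘ Equiv.swap u v) else 0)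
      = if G.Adj m n then 1 else 0 := by
    rw [Finset.sum_eq_single m, Finset.sum_eq_single n]
    · by_cases hadj : G.Adj m n
      · simp [singleDown_comp_swap, hadj, singleDown, hadj.ne']
      · simp [hadj]
    · intro v _ hv
      rw [singleDown_comp_swap, Pi.single_eq_of_ne (singleDown_injective.ne hv), ite_self]
    · simp
    · intro u _ hu
      simp [singleDown, hu]
    · simp
  rw [hsum, downCard_singleDown, innerPairs_singleDown] at h
  rw [H1, of_apply]
  simp only [col_apply] at h
  rw [h]
  simp only [Pi.single_apply, singleDown_injective.eq_iff, eq_comm (a := m)]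
  split_ifs <;> simp

/-- The configuration whose down-set is the range of `f`. -/
def rangeConf [DecidableEq V] {a : ℕ} (f : Fin a → V) : Conf V := fun u => decide (∃ i, f i = u)

lemma rangeConf_eq_true [DecidableEq V] {a : ℕ} {f : Fin a → V} {u : V} :
    rangeConf f u = true ↔ ∃ i, f i = u := by simp [rangeConf]

lemma rangeConf_eq_iff [DecidableEq V] {a : ℕ} {f : Fin a → V} {σ : Conf V} :
    rangeConf f = σ ↔ ∀ u, σ u = true ↔ ∃ i, f i = u := by
  rw [funext_iff]
  refine forall_congr' fun u => ?_
  rw [← rangeConf_eq_true, Bool.eq_iff_iff]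
  exact iff_comm

lemma downCard_rangeConf [Fintype V] [DecidableEq V] {a : ℕ} {f : Fin a → V}
    (hf : Function.Injective f) : downCard (rangeConf f) = a := by
  have : (Finset.univ.filter fun u => rangeConf f u = true) = Finset.univ.image f := by
    ext u
    simp [rangeConf_eq_true]
  rw [downCard, this, Finset.card_image_of_injective _ hf, Finset.card_fin]

lemma Ja_mulVec [Fintype V] [DecidableEq V] (a : ℕ) (ψ : Conf V → ℂ) (f : Fin a → V) :
    (Ja a *ᵥ ψ) f =
      if Function.Injective f then (Real.sqrt (Nat.factorial a) : ℂ)⁻¹ * ψ (rangeConf f) else 0 := by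
  simp [Ja, mulVec, dotProduct, ← rangeConf_eq_iff, ite_and]

lemma kron_mulVec {W : Type*} [Fintype W] [DecidableEq W] (a : ℕ) (M : Matrix W W ℂ)
    (φ : (Fin a → W) → ℂ) (f : Fin a → W) :
    (kron a M *ᵥ φ) f = ∑ i, ∑ w, M (f i) w * φ (Function.update f i w) := by
  simp only [kron, mulVec, dotProduct, of_apply, Finset.sum_mul]
  rw [Finset.sum_comm]
  refine Finset.sum_congr rfl fun i _ => ?_
  have hprod (g : Fin a → W) : (∏ k ∈ Finset.univ.erase i, if f k = g k then (1 : ℂ) else 0)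
      = if g = Function.update f i (g i) then 1 else 0 := by
    rw [Finset.prod_ite_zero, Finset.prod_const_one]
    congr 1
    simp only [Function.eq_update_iff, Finset.mem_erase, Finset.mem_univ, and_true, true_and,
      eq_comm]
  simp only [hprod]
  symm
  refine Finset.sum_of_injOn (Function.update f i) (Function.update_injective f i).injOn
    (by simp) (fun g _ hg => ?_) (fun w _ => by simp)
  rw [if_neg, mul_zero, zero_mul]
  rintro h
  exact hg ⟨g i, by simp, h.symm⟩

lemma update_injective_iff {W : Type*} [DecidableEq W] {a : ℕ} {f : Fin a → W}
    (hf : Function.Injective f) (i : Fin a) (w : W) :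
    Function.Injective (Function.update f i w) ↔ ∀ k, f k = w → k = i := by
  constructor
  · intro h k hk
    by_contra hne
    exact hne (h (by simp [hne, hk]))
  · intro h k l hkl
    simp only [Function.update_apply] at hkl
    split_ifs at hkl with h1 h2 h2
    · rw [h1, h2]
    · exact absurd (h l hkl.symm) h2
    · exact absurd (h k hkl) h1
    · exact hf hkl

lemma rangeConf_update [DecidableEq V] {a : ℕ} {f : Fin a → V}
    (hf : Function.Injective f) (i : Fin a) {v : V} (hv : rangeConf f v = false) :
    rangeConf (Function.update f i v) = rangeConf f ∘ Equiv.swap (f i) v := by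
  have hv' : ∀ k, f k ≠ v := fun k hk => by
    rw [rangeConf_eq_true.2 ⟨k, hk⟩] at hv
    exact absurd hv (by simp)
  rw [rangeConf_eq_iff]
  intro u
  rw [Function.comp_apply, rangeConf_eq_true]
  refine exists_congr fun k => ?_
  rw [eq_comm, Equiv.swap_apply_eq_iff, eq_comm]
  rcases eq_or_ne k i with rfl | hk
  · simp
  · rw [Equiv.swap_apply_of_ne_of_ne (hf.ne hk) (hv' k), Function.update_of_ne hk]

lemma sum_rangeConf [Fintype V] [DecidableEq V] {a : ℕ} {f : Fin a → V}
    (hf : Function.Injective f) (F : V → ℂ) :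
    ∑ i, F (f i) = ∑ u, if rangeConf f u = true then F u else 0 := by
  rw [← Finset.sum_filter, ← Finset.sum_image (f := F) (g := f) (s := Finset.univ) hf.injOn]
  refine Finset.sum_congr ?_ fun _ _ => rfl
  ext u
  simp [rangeConf_eq_true]

/-- At an injective tuple, the Kronecker sum of the one-magnon block differs from `H` only by
a diagonal term. -/
lemma kron_H1_mulVec_Ja [Fintype V] [DecidableEq V] (G : SimpleGraph V) [DecidableRel G.Adj]
    {j : ℕ} (hreg : G.IsRegularOfDegree j) {a : ℕ} (ψ : Conf V → ℂ) {f : Fin a → V}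
    (hf : Function.Injective f) :
    (kron a (H1 G) *ᵥ (Ja a *ᵥ ψ)) f = (Real.sqrt (Nat.factorial a) : ℂ)⁻¹ *
      ((Ham G *ᵥ ψ) (rangeConf f) - ((1 - (a : ℂ)) * (Fintype.card V : ℂ) * (j : ℂ) / 8
        + innerPairs G (rangeConf f) / 2) * ψ (rangeConf f)) := by
  set c := (Real.sqrt (Nat.factorial a) : ℂ)⁻¹
  have hterm (i : Fin a) (v : V) : H1 G (f i) v * (Ja a *ᵥ ψ) (Function.update f i v) =
      c * ((if v = f i then ((Fintype.card V : ℂ) * j / 8 - j / 2) * ψ (rangeConf f) else 0)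
        + 1 / 2 * if G.Adj (f i) v ∧ rangeConf f v = false
          then ψ (rangeConf f ∘ Equiv.swap (f i) v) else 0) := by
    rw [H1_apply G hreg, Ja_mulVec]
    simp only [update_injective_iff hf]
    rcases eq_or_ne v (f i) with rfl | hne
    · rw [if_pos fun k hk => hf hk]
      simp [c]
      ring
    · cases hv : rangeConf f v
      · have hinj : ∀ k, f k = v → k = i := fun k hk => by
          rw [rangeConf_eq_true.2 ⟨k, hk⟩] at hv
          exact absurd hv (by simp)
        rw [if_pos hinj, rangeConf_update hf i hv]
        by_cases hadj : G.Adj (f i) v <;> simp [hne, hadj, c]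
        ring
      · obtain ⟨k, hk⟩ := rangeConf_eq_true.1 hv
        have hninj : ¬ ∀ k, f k = v → k = i := fun h => hne (by rw [← h k hk, hk])
        rw [if_neg hninj]
        simp [hne]
  rw [kron_mulVec, Ham_mulVec G hreg, downCard_rangeConf hf]
  simp only [hterm, ← Finset.mul_sum, Finset.sum_add_distrib, Finset.sum_ite_eq',
    Finset.mem_univ, if_true, Finset.sum_const, Finset.card_univ, Fintype.card_fin, nsmul_eq_mul]
  rw [sum_rangeConf hf (fun u => ∑ v, if G.Adj u v ∧ rangeConf f v = false
    then ψ (rangeConf f ∘ Equiv.swap u v) else 0)]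
  have hS : (∑ u, if rangeConf f u = true then ∑ v, (if G.Adj u v ∧ rangeConf f v = false
      then ψ (rangeConf f ∘ Equiv.swap u v) else 0) else 0) =
      ∑ u, ∑ v, if G.Adj u v ∧ rangeConf f u = true ∧ rangeConf f v = false
          then ψ (rangeConf f ∘ Equiv.swap u v) else 0 := by
    refine Finset.sum_congr rfl fun u _ => ?_
    cases rangeConf f u <;> simp
  rw [hS]
  ring

/-- Every configuration with `a` down spins is enumerated by `a!` injective tuples. -/
lemma card_injective_rangeConf [Fintype V] [DecidableEq V] {a : ℕ} {σ : Conf V}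
    (hσ : downCard σ = a) :
    (Finset.univ.filter fun f : Fin a → V => Function.Injective f ∧ rangeConf f = σ).card
      = Nat.factorial a := by
  have hcard : Fintype.card {u // σ u = true} = a := by
    rw [Fintype.card_subtype, ← hσ, downCard]
  have hequiv := Fintype.card_equiv (Fintype.equivFinOfCardEq hcard).symm
  rw [Fintype.card_fin, ← Finset.card_univ] at hequiv
  rw [← hequiv]
  symm
  refine Finset.card_bij (fun e _ i => (e i : V)) ?_ ?_ ?_
  · intro e _
    simp only [Finset.mem_filter, Finset.mem_univ, true_and, rangeConf_eq_iff]
    refine ⟨Subtype.val_injective.comp e.injective, fun u => ⟨fun hu => ?_, ?_⟩⟩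
    · exact ⟨e.symm ⟨u, hu⟩, by simp⟩
    · rintro ⟨i, rfl⟩
      exact (e i).2
  · intro e _ e' _ h
    ext i
    exact congrFun h i
  · intro f hf
    simp only [Finset.mem_filter, Finset.mem_univ, true_and, rangeConf_eq_iff] at hf
    obtain ⟨hinj, hr⟩ := hf
    refine ⟨Equiv.ofBijective (fun i => ⟨f i, (hr _).2 ⟨i, rfl⟩⟩) ⟨fun i k h => hinj ?_, ?_⟩,
      Finset.mem_univ _, rfl⟩
    · simpa using h
    · rintro ⟨u, hu⟩
      obtain ⟨i, hi⟩ := (hr u).1 hu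
      exact ⟨i, Subtype.ext hi⟩

/-- Summing over injective tuples counts each configuration with `a` down spins `a!` times. -/
lemma sum_injective_rangeConf [Fintype V] [DecidableEq V] {a : ℕ} (F : Conf V → ℂ)
    (hF : ∀ σ, F σ ≠ 0 → downCard σ = a) :
    (∑ f : Fin a → V, if Function.Injective f then F (rangeConf f) else 0)
      = Nat.factorial a * ∑ σ, F σ := by
  rw [← Finset.sum_filter, ← Finset.sum_fiberwise' _ rangeConf F, Finset.mul_sum]
  refine Finset.sum_congr rfl fun σ _ => ?_
  rw [Finset.sum_const, nsmul_eq_mul, Finset.filter_filter]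
  by_cases h : F σ = 0
  · simp [h]
  · rw [card_injective_rangeConf (hF σ h)]

/-- (Proposition 2) For every vector `ψ` in the `a`-magnon sector,
`⟨ψ, H ψ⟩ ≥ ((1−a)·N·j/8)·‖ψ‖² + ⟨𝒥_a ψ, K_a 𝒥_a ψ⟩`. -/
theorem prop2_operator_inequality [Fintype V] [DecidableEq V]
    (G : SimpleGraph V) [DecidableRel G.Adj] (N j : ℕ)
    (hN : Fintype.card V = N) (hreg : G.IsRegularOfDegree j)
    (a : ℕ) (ha : 1 ≤ a)
    (ψ : Conf V → ℂ) (hψ : ∀ σ : Conf V, ψ σ ≠ 0 → downCard σ = a) :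
    ((1 - (a : ℂ)) * (N : ℂ) * (j : ℂ) / 8) * (star ψ ⬝ᵥ ψ)
        + star (Ja a *ᵥ ψ) ⬝ᵥ (kron a (H1 G) *ᵥ (Ja a *ᵥ ψ))
      ≤ star ψ ⬝ᵥ (Ham G *ᵥ ψ) := by
  subst hN
  have hJ : star (Ja a *ᵥ ψ) ⬝ᵥ (kron a (H1 G) *ᵥ (Ja a *ᵥ ψ)) =
      ∑ σ, star (ψ σ) * ((Ham G *ᵥ ψ) σ - ((1 - (a : ℂ)) * (Fintype.card V : ℂ) * (j : ℂ) / 8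
        + innerPairs G σ / 2) * ψ σ) := by
    have hc : (Real.sqrt (Nat.factorial a) : ℂ)⁻¹ * (Real.sqrt (Nat.factorial a) : ℂ)⁻¹
        * Nat.factorial a = 1 := by
      have hsq : (Real.sqrt (Nat.factorial a) : ℂ) * (Real.sqrt (Nat.factorial a) : ℂ)
          = Nat.factorial a := by
        exact_mod_cast Real.mul_self_sqrt (Nat.cast_nonneg (Nat.factorial a))
      have hne : (Nat.factorial a : ℂ) ≠ 0 := by exact_mod_cast Nat.factorial_ne_zero a
      rw [← mul_inv, hsq, inv_mul_cancel₀ hne]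
    have hsum := sum_injective_rangeConf (a := a) (fun σ => star (ψ σ) * ((Ham G *ᵥ ψ) σ -
      ((1 - (a : ℂ)) * (Fintype.card V : ℂ) * (j : ℂ) / 8 + innerPairs G σ / 2) * ψ σ))
      fun σ h => hψ σ fun h0 => h (by simp [h0])
    refine Eq.trans ?_ (one_mul _)
    rw [← congrArg (· * _) hc]
    rw [mul_assoc, ← hsum, Finset.mul_sum, dotProduct]
    refine Finset.sum_congr rfl fun f _ => ?_
    rw [Pi.star_apply, Ja_mulVec]
    split_ifs with hf
    · rw [kron_H1_mulVec_Ja G hreg ψ hf, star_mul', star_inv₀, Complex.star_def,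
        Complex.conj_ofReal]
      ring
    · simp
  rw [hJ, ← sub_nonneg]
  have hdiff : star ψ ⬝ᵥ (Ham G *ᵥ ψ) -
      (((1 - (a : ℂ)) * (Fintype.card V : ℂ) * (j : ℂ) / 8) * (star ψ ⬝ᵥ ψ)
        + ∑ σ, star (ψ σ) * ((Ham G *ᵥ ψ) σ - ((1 - (a : ℂ)) * (Fintype.card V : ℂ) * (j : ℂ) / 8
        + innerPairs G σ / 2) * ψ σ)) =
      ∑ σ, (innerPairs G σ : ℂ) / 2 * (star (ψ σ) * ψ σ) := by
    simp only [dotProduct, Pi.star_apply, Finset.mul_sum, ← Finset.sum_add_distrib,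
      ← Finset.sum_sub_distrib]
    exact Finset.sum_congr rfl fun σ _ => by ring
  rw [hdiff]
  exact Finset.sum_nonneg fun σ _ => mul_nonneg (by positivity) (star_mul_self_nonneg _)
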